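/- arXiv:2507.11294 — 3 statements merged into one kernel-verified Lean document; each statement's English description precedes it below -/
import Mathlib

section
/- Fix an integer d ≥ 1. Let φ : [0,∞) → M_{d,d}(ℝ) be a matrix-valued measurable function with nonnegative entries, each entry being Lebesgue integrable, and let A ∈ M_{d,d}(ℝ) be the matrix with entries A_{ij} = ∫₀^∞ φ^{ij}(s) ds. Assume Aⁿ → 0 entrywise as n → ∞ (equivalently, the spectral radius of the nonnegative matrix A is strictly less than one). Let g ∈ [0,∞)^d be a constant vector and let f : [0,∞) → [0,∞)^d be measurable and bounded on every compact interval, satisfying the componentwise inequality f(t) ≤ g + ∫₀^t φ(t−s) f(s) ds for all t ≥ 0. Then the matrix I − A is invertible and f(t) ≤ (I − A)^{-1} g componentwise for all t ≥ 0. -/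
open MeasureTheory Filter Set

/-- If the powers of a real square matrix tend to zero, then `1 - A` is invertible. -/
theorem isUnit_one_sub_of_tendsto_pow_zero {n : Type*} [Fintype n] [DecidableEq n]
    {A : Matrix n n ℝ} (hA : Tendsto (fun k : ℕ => A ^ k) atTop (nhds 0)) :
    IsUnit (1 - A) := by
  rw [Matrix.isUnit_iff_isUnit_det, isUnit_iff_ne_zero]
  intro hdet
  obtain ⟨v, hv, hAv⟩ := Matrix.exists_mulVec_eq_zero_iff.mpr hdet
  have hfix : A.mulVec v = v := by
    rw [Matrix.sub_mulVec, Matrix.one_mulVec, sub_eq_zero] at hAv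
    exact hAv.symm
  have hpow : ∀ k : ℕ, (A ^ k).mulVec v = v := by
    intro k
    induction k with
    | zero => simp
    | succ k ih => rw [pow_succ, ← Matrix.mulVec_mulVec, hfix, ih]
  have hlim : Tendsto (fun k : ℕ => (A ^ k).mulVec v) atTop (nhds ((0 : Matrix n n ℝ).mulVec v)) :=
    ((continuous_id.matrix_mulVec continuous_const).tendsto (0 : Matrix n n ℝ)).comp hA
  simp only [hpow, Matrix.zero_mulVec] at hlim
  exact hv (tendsto_nhds_unique tendsto_const_nhds hlim)

/-- A Volterra convolution of a nonnegative matrix kernel with a nonnegative function bounded by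
a constant vector is bounded by the matrix of total masses applied to that vector. -/
theorem integral_convolution_le_mulVec {n : Type*} [Fintype n]
    {φ : ℝ → Matrix n n ℝ}
    (hφ_nonneg : ∀ t ∈ Ici (0 : ℝ), ∀ i j, 0 ≤ φ t i j)
    (hφ_int : ∀ i j, IntegrableOn (fun t => φ t i j) (Ioi (0 : ℝ)))
    {A : Matrix n n ℝ} (hA : ∀ i j, A i j = ∫ t in Ioi (0 : ℝ), φ t i j)
    {f : ℝ → n → ℝ} {v : n → ℝ} {t : ℝ} (ht : 0 ≤ t)
    (hf_nonneg : ∀ s ∈ Icc 0 t, ∀ i, 0 ≤ f s i) (hfv : ∀ s ∈ Icc 0 t, ∀ i, f s i ≤ v i) (i : n) :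
    ∫ s in (0 : ℝ)..t, ∑ j, φ (t - s) i j * f s j ≤ A.mulVec v i := by
  have hv : ∀ j, 0 ≤ v j := fun j =>
    (hf_nonneg 0 ⟨le_rfl, ht⟩ j).trans (hfv 0 ⟨le_rfl, ht⟩ j)
  have hint : ∀ j, IntervalIntegrable (fun s => φ s i j) volume 0 t := fun j =>
    (intervalIntegrable_iff_integrableOn_Ioc_of_le ht).mpr
      ((hφ_int i j).mono_set Ioc_subset_Ioi_self)
  have hint' : ∀ j, IntervalIntegrable (fun s => φ (t - s) i j * v j) volume 0 t := fun j => by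
    simpa using (((hint j).comp_sub_left t).symm).mul_const (v j)
  have hφ_sub : ∀ s ∈ Ioc 0 t, ∀ j, 0 ≤ φ (t - s) i j := fun s hs j =>
    hφ_nonneg _ (sub_nonneg.mpr hs.2) i j
  calc ∫ s in (0 : ℝ)..t, ∑ j, φ (t - s) i j * f s j
      ≤ ∫ s in (0 : ℝ)..t, ∑ j, φ (t - s) i j * v j := by
        rw [intervalIntegral.integral_of_le ht, intervalIntegral.integral_of_le ht]
        refine integral_mono_of_nonneg ?_ ?_ ?_
        · filter_upwards [ae_restrict_mem measurableSet_Ioc] with s hs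
          exact Finset.sum_nonneg fun j _ =>
            mul_nonneg (hφ_sub s hs j) (hf_nonneg s (Ioc_subset_Icc_self hs) j)
        · exact integrable_finsetSum _ fun j _ =>
            (intervalIntegrable_iff_integrableOn_Ioc_of_le ht).mp (hint' j)
        · filter_upwards [ae_restrict_mem measurableSet_Ioc] with s hs
          exact Finset.sum_le_sum fun j _ =>
            mul_le_mul_of_nonneg_left (hfv s (Ioc_subset_Icc_self hs) j) (hφ_sub s hs j)
    _ = ∑ j, (∫ s in (0 : ℝ)..t, φ s i j) * v j := by
        rw [intervalIntegral.integral_finsetSum fun j _ => hint' j]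
        refine Finset.sum_congr rfl fun j _ => ?_
        rw [intervalIntegral.integral_mul_const,
          intervalIntegral.integral_comp_sub_left (fun s => φ s i j) t, sub_self, sub_zero]
    _ ≤ A.mulVec v i := by
        refine Finset.sum_le_sum fun j _ => mul_le_mul_of_nonneg_right ?_ (hv j)
        change _ ≤ A i j
        rw [hA, intervalIntegral.integral_of_le ht]
        refine setIntegral_mono_set (hφ_int i j) ?_ Ioc_subset_Ioi_self.eventuallyLE
        filter_upwards [ae_restrict_mem measurableSet_Ioi] with s hs
        exact hφ_nonneg s (Ioi_subset_Ici_self hs) i j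

/-- Matrix-kernel Grönwall-type inequality with a constant
right-hand side: if the matrix `A` of `L¹`-norms of the entries of the
nonnegative matrix kernel `φ` satisfies `Aⁿ → 0` (spectral radius `< 1`),
`g ∈ [0,∞)^d` is a constant vector, `f` is nonnegative measurable bounded on
compacts, and componentwise `f(t) ≤ g + ∫₀^t φ(t−s) f(s) ds` for `t ≥ 0`,
then `I − A` is invertible and `f(t) ≤ (I − A)⁻¹ g` componentwise for all
`t ≥ 0`. -/
theorem gronwall_volterra_matrix_const
    (d : ℕ) (hd : 1 ≤ d)
    (φ : ℝ → Matrix (Fin d) (Fin d) ℝ)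
    (hφ_meas : ∀ i j, Measurable fun t => φ t i j)
    (hφ_nonneg : ∀ t ∈ Set.Ici (0:ℝ), ∀ i j, 0 ≤ φ t i j)
    (hφ_int : ∀ i j, IntegrableOn (fun t => φ t i j) (Set.Ioi (0:ℝ)))
    (A : Matrix (Fin d) (Fin d) ℝ)
    (hA : ∀ i j, A i j = ∫ t in Set.Ioi (0:ℝ), φ t i j)
    (hA_pow : Tendsto (fun n : ℕ => A ^ n) atTop (nhds 0))
    (g : Fin d → ℝ)
    (hg_nonneg : ∀ i, 0 ≤ g i)
    (f : ℝ → Fin d → ℝ)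
    (hf_meas : ∀ i, Measurable fun t => f t i)
    (hf_nonneg : ∀ t ∈ Set.Ici (0:ℝ), ∀ i, 0 ≤ f t i)
    (hf_bdd : ∀ T > (0:ℝ), ∃ M : ℝ, ∀ t ∈ Set.Icc (0:ℝ) T, ∀ i, f t i ≤ M)
    (hineq : ∀ t ≥ (0:ℝ), ∀ i,
      f t i ≤ g i + ∫ s in (0:ℝ)..t, ∑ j, φ (t - s) i j * f s j) :
    IsUnit (1 - A) ∧ ∀ t ≥ (0:ℝ), ∀ i, f t i ≤ (1 - A)⁻¹.mulVec g i := by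
  have hunit := isUnit_one_sub_of_tendsto_pow_zero hA_pow
  refine ⟨hunit, fun t ht i => ?_⟩
  set w := (1 - A)⁻¹.mulVec g with hw
  have hwfix : g + A.mulVec w = w := by
    have h : (1 - A).mulVec w = g := by
      rw [hw, Matrix.mulVec_mulVec,
        Matrix.mul_nonsing_inv _ ((Matrix.isUnit_iff_isUnit_det _).mp hunit), Matrix.one_mulVec]
    rw [Matrix.sub_mulVec, Matrix.one_mulVec] at h
    rw [← h, sub_add_cancel]
  obtain ⟨M, hM⟩ := hf_bdd (t + 1) (by linarith)
  set u : Fin d → ℝ := (fun _ => M) - w with hu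
  have hiter : ∀ n : ℕ, ∀ s ∈ Icc 0 t, ∀ k, f s k ≤ (w + (A ^ n).mulVec u) k := by
    intro n
    induction n with
    | zero =>
      intro s hs k
      simpa [hu] using hM s ⟨hs.1, by linarith [hs.2]⟩ k
    | succ n ih =>
      intro s hs k
      have hstep : w + (A ^ (n + 1)).mulVec u = g + A.mulVec (w + (A ^ n).mulVec u) := by
        rw [Matrix.mulVec_add, ← add_assoc, hwfix, Matrix.mulVec_mulVec, pow_succ']
      rw [hstep]
      exact (hineq s hs.1 k).trans (add_le_add le_rfl
        (integral_convolution_le_mulVec hφ_nonneg hφ_int hA hs.1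
          (fun r hr => hf_nonneg r hr.1) (fun r hr => ih r ⟨hr.1, hr.2.trans hs.2⟩) k))
  have hlim : Tendsto (fun n : ℕ => (w + (A ^ n).mulVec u) i) atTop (nhds (w i)) := by
    have hcont : Continuous fun B : Matrix (Fin d) (Fin d) ℝ => (w + B.mulVec u) i :=
      (continuous_apply i).comp
        (continuous_const.add (continuous_id.matrix_mulVec continuous_const))
    simpa [Function.comp_def] using (hcont.tendsto 0).comp hA_pow
  exact ge_of_tendsto' hlim fun n => hiter n t ⟨ht, le_rfl⟩ i
end

section
/- Let φ : [0,∞) → ℝ be Lebesgue integrable and let β > 0. Then for every ε > 0 there exist an integer n ≥ 1 and real coefficients η₁, …, η_n such that ∫₀^∞ | φ(t) − Σ_{k=1}^n η_k e^{−βkt} | dt ≤ ε. -/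
open MeasureTheory Filter Set

/-- The pullback `x ↦ g (-log x / β) / x` of a compactly supported continuous function under
`x = exp (-β t)`, with the weight `1 / x`, is continuous, including at `x = 0`. -/
lemma continuous_comp_neg_log_div_div {g : ℝ → ℝ} (hg : Continuous g) (hgc : HasCompactSupport g)
    {β : ℝ} (hβ : 0 < β) : Continuous fun x : ℝ => g (-Real.log x / β) / x := by
  rw [continuous_iff_continuousAt]
  intro x
  rcases eq_or_ne x 0 with rfl | hx
  · have hlim : Tendsto (fun x : ℝ => -Real.log x / β) (nhdsWithin 0 {0}ᶜ) atTop :=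
      (tendsto_neg_atBot_atTop.comp Real.tendsto_log_nhdsNE_zero).atTop_div_const hβ
    have hzero : ∀ᶠ t in atTop, g t = 0 := by
      have h := hasCompactSupport_iff_eventuallyEq.1 hgc
      rw [coclosedCompact_eq_cocompact] at h
      exact h.filter_mono atTop_le_cocompact
    have h : (fun x : ℝ => g (-Real.log x / β) / x) =ᶠ[nhds 0] fun _ => (0 : ℝ) := by
      filter_upwards [eventually_nhdsWithin_iff.1 (hlim.eventually hzero)] with x hx
      rcases eq_or_ne x 0 with rfl | hx0
      · simp
      · simp [hx hx0]
    exact continuousAt_const.congr h.symm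
  · exact (hg.continuousAt.comp ((Real.continuousAt_log hx).neg.div_const β)).div continuousAt_id hx

/-- A polynomial multiple `exp (-β t) * p (exp (-β t))` written as an exponential sum. -/
lemma exp_mul_eval_exp (p : Polynomial ℝ) (β t : ℝ) :
    Real.exp (-β * t) * p.eval (Real.exp (-β * t)) =
      ∑ k : Fin (p.natDegree + 1), p.coeff k * Real.exp (-β * ((k : ℕ) + 1) * t) := by
  rw [Polynomial.eval_eq_sum_range, Finset.mul_sum,
    Fin.sum_univ_eq_sum_range fun k => p.coeff k * Real.exp (-β * ((k : ℕ) + 1) * t)]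
  refine Finset.sum_congr rfl fun k _ => ?_
  rw [← Real.exp_nat_mul, mul_left_comm, ← Real.exp_add]
  ring_nf

/-- If `φ : [0,∞) → ℝ` is Lebesgue integrable and `β > 0`,
then for every `ε > 0` there exist `n ≥ 1` and real coefficients `η₁, …, η_n`
with `∫₀^∞ |φ(t) − Σ_{k=1}^n η_k e^{−βkt}| dt ≤ ε`. -/
theorem exp_sum_L1_approx
    (φ : ℝ → ℝ)
    (hφ_meas : Measurable φ)
    (hφ_int : IntegrableOn φ (Set.Ioi (0:ℝ)))
    (β : ℝ) (hβ : 0 < β)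
    (ε : ℝ) (hε : 0 < ε) :
    ∃ (n : ℕ), 1 ≤ n ∧ ∃ η : Fin n → ℝ,
      (∫ t in Set.Ioi (0:ℝ),
        |φ t - ∑ k : Fin n, η k * Real.exp (-β * ((k : ℕ) + 1) * t)|) ≤ ε := by
  obtain ⟨g, hgc, hφg, hg, hg_int⟩ :=
    Integrable.exists_hasCompactSupport_integral_sub_le hφ_int (half_pos hε)
  obtain ⟨p, hp⟩ := exists_polynomial_near_of_continuousOn 0 1 _
    (continuous_comp_neg_log_div_div hg hgc hβ).continuousOn (β * (ε / 2)) (by positivity)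
  refine ⟨p.natDegree + 1, by lia, fun k => p.coeff k, ?_⟩
  simp_rw [← exp_mul_eval_exp]
  have hexp : IntegrableOn (fun t => Real.exp (-β * t)) (Ioi 0) :=
    integrableOn_exp_mul_Ioi (neg_neg_of_pos hβ) 0
  have hdiff : IntegrableOn (fun t => |φ t - g t|) (Ioi 0) := (hφ_int.sub hg_int).abs
  have hbound : ∀ t ∈ Ioi (0 : ℝ),
      |φ t - Real.exp (-β * t) * p.eval (Real.exp (-β * t))| ≤
        |φ t - g t| + β * (ε / 2) * Real.exp (-β * t) := by
    intro t ht
    have hpos := Real.exp_pos (-β * t)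
    have hle : Real.exp (-β * t) ≤ 1 :=
      Real.exp_le_one_iff.2 (by nlinarith [mem_Ioi.1 ht])
    have h := (hp _ ⟨hpos.le, hle⟩).le
    have harg : -(-β * t) / β = t := by field_simp
    rw [Real.log_exp, harg] at h
    have hsub : Real.exp (-β * t) * p.eval (Real.exp (-β * t)) - g t =
        (p.eval (Real.exp (-β * t)) - g t / Real.exp (-β * t)) * Real.exp (-β * t) := by
      field_simp
    calc _ ≤ |φ t - g t| + |g t - Real.exp (-β * t) * p.eval (Real.exp (-β * t))| :=
          abs_sub_le _ _ _
      _ ≤ _ := by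
        rw [abs_sub_comm (g t), hsub, abs_mul, abs_of_pos hpos]
        gcongr
  calc _ ≤ ∫ t in Ioi (0 : ℝ), (|φ t - g t| + β * (ε / 2) * Real.exp (-β * t)) :=
        integral_mono_of_nonneg (ae_of_all _ fun _ => abs_nonneg _)
          (hdiff.add (hexp.const_mul _))
          ((ae_restrict_iff' measurableSet_Ioi).2 (ae_of_all _ hbound))
    _ = (∫ t in Ioi (0 : ℝ), |φ t - g t|) + ε / 2 := by
        rw [integral_add hdiff (hexp.const_mul _), integral_const_mul,
          integral_exp_mul_Ioi (neg_neg_of_pos hβ)]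
        simp
        field_simp
    _ ≤ ε := by
        simp only [Real.norm_eq_abs] at hφg
        linarith
end

section
/- Let β > 0 and let φ : [0,∞) → ℝ be measurable with both ∫₀^∞ |φ(t)| dt < ∞ and ∫₀^∞ φ(t)² dt < ∞. Then for every ε > 0 there exist an integer n ≥ 1 and real coefficients η₁, …, η_n such that, writing g(t) = Σ_{k=1}^n η_k e^{−βkt}, both ∫₀^∞ |φ(t) − g(t)| dt ≤ ε and (∫₀^∞ (φ(t) − g(t))² dt)^{1/2} ≤ ε. -/
open MeasureTheory Filter Set

/-- The sum of the integrands of the `L¹` norm and of the squared `L²` norm is quasi-subadditive. -/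
lemma abs_add_sq_add_three_le (a b c : ℝ) :
    |a + b + c| + (a + b + c) ^ 2 ≤ 3 * ((|a| + a ^ 2) + (|b| + b ^ 2) + (|c| + c ^ 2)) := by
  have := abs_add_three a b c
  nlinarith [sq_nonneg (a - b), sq_nonneg (b - c), sq_nonneg (a - c), abs_nonneg a,
    abs_nonneg b, abs_nonneg c]

/-- Truncation of a real number to `[-M, M]`. -/
def truncate (M x : ℝ) : ℝ := max (-M) (min M x)

lemma continuous_truncate (M : ℝ) : Continuous (truncate M) := by
  unfold truncate; fun_prop

lemma truncate_zero {M : ℝ} (hM : 0 ≤ M) : truncate M 0 = 0 := by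
  simp [truncate, hM]

lemma truncate_of_abs_le {M x : ℝ} (h : |x| ≤ M) : truncate M x = x := by
  rw [abs_le] at h
  simp [truncate, h.1, h.2]

lemma abs_truncate_le {M : ℝ} (hM : 0 ≤ M) (x : ℝ) : |truncate M x| ≤ M := by
  rw [abs_le]
  exact ⟨le_max_left _ _, max_le (by linarith) (min_le_left _ _)⟩

lemma abs_truncate_sub_truncate_le (M x y : ℝ) : |truncate M x - truncate M y| ≤ |x - y| :=
  calc |truncate M x - truncate M y| ≤ |min M x - min M y| := by
        simpa [truncate, max_comm (-M)] using abs_max_sub_max_le_abs (min M x) (min M y) (-M)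
    _ ≤ |x - y| := by simpa using abs_min_sub_min_le_max M x M y

lemma abs_truncate_le_abs {M : ℝ} (hM : 0 ≤ M) (x : ℝ) : |truncate M x| ≤ |x| := by
  simpa [truncate_zero hM] using abs_truncate_sub_truncate_le M x 0

lemma abs_sub_truncate_le {M : ℝ} (hM : 0 ≤ M) (x : ℝ) : |x - truncate M x| ≤ |x| := by
  unfold truncate
  rcases max_cases (-M) (min M x) with h | h <;> rcases min_cases M x with h' | h' <;>
    rcases abs_cases x with h'' | h'' <;> rw [abs_le] <;> constructor <;> linarith

/-- Truncations of a function in `L¹ ∩ L²` approximate it in both norms. -/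
lemma exists_truncate_integral_le {μ : Measure ℝ} {φ : ℝ → ℝ} (hφ_meas : Measurable φ)
    (hφ_int : Integrable φ μ) (hφ_sq : Integrable (fun t => φ t ^ 2) μ) {δ : ℝ} (hδ : 0 < δ) :
    ∃ M : ℝ, 0 ≤ M ∧
      ∫ t, (|φ t - truncate M (φ t)| + (φ t - truncate M (φ t)) ^ 2) ∂μ ≤ δ := by
  have key : Tendsto (fun n : ℕ =>
      ∫ t, (|φ t - truncate n (φ t)| + (φ t - truncate n (φ t)) ^ 2) ∂μ) atTop
      (nhds (∫ _, (0 : ℝ) ∂μ)) := by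
    refine tendsto_integral_of_dominated_convergence (fun t => |φ t| + φ t ^ 2) ?_
      (hφ_int.abs.add hφ_sq) ?_ ?_
    · intro n
      have := (continuous_truncate n).measurable.comp hφ_meas
      have h2 : Measurable fun t => φ t - truncate n (φ t) := hφ_meas.sub this
      exact ((h2.abs).add (h2.pow_const 2)).aestronglyMeasurable
    · intro n
      refine ae_of_all _ fun t => ?_
      have h := abs_sub_truncate_le (Nat.cast_nonneg n) (φ t)
      rw [Real.norm_of_nonneg (by positivity)]
      exact add_le_add h (sq_le_sq.2 h)
    · refine ae_of_all _ fun t => tendsto_const_nhds.congr' ?_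
      obtain ⟨N, hN⟩ := exists_nat_ge |φ t|
      filter_upwards [eventually_ge_atTop N] with n hn
      rw [truncate_of_abs_le (hN.trans (by exact_mod_cast hn))]
      simp
  rw [integral_zero] at key
  obtain ⟨n, hn⟩ := (key.eventually (eventually_le_nhds hδ)).exists
  exact ⟨n, Nat.cast_nonneg n, hn⟩

/-- A bounded integrable function is approximated in `L¹` and `L²` at once by continuous functions
with compact support. -/
lemma exists_hasCompactSupport_integral_abs_add_sq_le {μ : Measure ℝ} [μ.Regular]
    {φ : ℝ → ℝ} (hφ_int : Integrable φ μ) {M : ℝ} (hM : 0 ≤ M) (hφ : ∀ t, |φ t| ≤ M)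
    {δ : ℝ} (hδ : 0 < δ) :
    ∃ h : ℝ → ℝ, Continuous h ∧ HasCompactSupport h ∧
      Integrable (fun t => |φ t - h t| + (φ t - h t) ^ 2) μ ∧
      ∫ t, (|φ t - h t| + (φ t - h t) ^ 2) ∂μ ≤ δ := by
  obtain ⟨f, hf_supp, hf_le, hf_cont, hf_int⟩ :=
    hφ_int.exists_hasCompactSupport_integral_sub_le (ε := δ / (1 + 2 * M)) (by positivity)
  have hcont : Continuous fun t => truncate M (f t) := (continuous_truncate M).comp hf_cont
  have hsupp : HasCompactSupport fun t => truncate M (f t) :=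
    hf_supp.comp_left (g := truncate M) (truncate_zero hM)
  have hb : ∀ t, |φ t - truncate M (f t)| + (φ t - truncate M (f t)) ^ 2
      ≤ (1 + 2 * M) * ‖φ t - f t‖ := by
    intro t
    have h1 := abs_truncate_sub_truncate_le M (φ t) (f t)
    rw [truncate_of_abs_le (hφ t)] at h1
    have h2 : |φ t - truncate M (f t)| ≤ 2 * M :=
      (abs_sub _ _).trans (by linarith [hφ t, abs_truncate_le hM (f t)])
    rw [Real.norm_eq_abs, ← sq_abs]
    nlinarith [abs_nonneg (φ t - truncate M (f t))]
  have hdom : Integrable (fun t => (1 + 2 * M) * ‖φ t - f t‖) μ :=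
    (hφ_int.sub hf_int).norm.const_mul _
  have hint : Integrable
      (fun t => |φ t - truncate M (f t)| + (φ t - truncate M (f t)) ^ 2) μ := by
    have hm : AEStronglyMeasurable (fun t => φ t - truncate M (f t)) μ :=
      hφ_int.1.sub hcont.aestronglyMeasurable
    refine hdom.mono' (hm.norm.add (hm.pow 2)) (ae_of_all _ fun t => ?_)
    rw [Real.norm_of_nonneg (by positivity)]
    exact hb t
  refine ⟨_, hcont, hsupp, hint, (integral_mono hint hdom hb).trans ?_⟩
  rw [integral_const_mul]
  calc _ ≤ (1 + 2 * M) * (δ / (1 + 2 * M)) := by gcongr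
    _ = δ := by field_simp

/-- Transporting a compactly supported continuous function to the variable `x = exp (-β t)` and
dividing by `x` gives a continuous function. -/
lemma continuous_comp_neg_log_div {β : ℝ} (hβ : 0 < β) {h : ℝ → ℝ} (hc : Continuous h)
    (hs : HasCompactSupport h) : Continuous fun x => h (-Real.log x / β) / x := by
  refine continuous_iff_continuousAt.2 fun x => ?_
  rcases eq_or_ne x 0 with rfl | hx
  · have hlim : Tendsto (fun x => -Real.log x / β) (nhdsWithin 0 {0}ᶜ) (cocompact ℝ) :=
      ((tendsto_neg_atBot_atTop.comp Real.tendsto_log_nhdsNE_zero).atTop_div_const hβ).mono_right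
        atTop_le_cocompact
    rw [← coclosedCompact_eq_cocompact] at hlim
    have h0 := hlim.eventually (hasCompactSupport_iff_eventuallyEq.1 hs)
    rw [eventually_nhdsWithin_iff] at h0
    refine (continuousAt_const (y := (0 : ℝ))).congr ?_
    filter_upwards [h0] with y hy
    by_cases hy0 : y = 0
    · simp [hy0]
    · simp [show h (-Real.log y / β) = 0 from hy hy0]
  · have : ContinuousAt (fun x => -Real.log x / β) x :=
      (Real.continuousAt_log hx).neg.div_const β
    exact (ContinuousAt.comp (f := fun x => -Real.log x / β) hc.continuousAt this).div
      continuousAt_id hx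

/-- A compactly supported continuous function is approximated on `[0, ∞)` by exponential sums,
uniformly relative to `exp (-β t)`. -/
lemma exists_exp_sum_near_of_hasCompactSupport {β : ℝ} (hβ : 0 < β) {h : ℝ → ℝ}
    (hc : Continuous h) (hs : HasCompactSupport h) {δ : ℝ} (hδ : 0 < δ) :
    ∃ n : ℕ, 1 ≤ n ∧ ∃ η : Fin n → ℝ, ∀ t : ℝ, 0 ≤ t →
      |h t - ∑ k : Fin n, η k * Real.exp (-β * ((k : ℕ) + 1) * t)| ≤ δ * Real.exp (-β * t) := by
  obtain ⟨p, hp⟩ := exists_polynomial_near_of_continuousOn 0 1 _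
    (continuous_comp_neg_log_div hβ hc hs).continuousOn δ hδ
  refine ⟨p.natDegree + 1, by lia, fun k => p.coeff k, fun t ht => ?_⟩
  have hx := hp (Real.exp (-β * t))
    ⟨(Real.exp_pos _).le, Real.exp_le_one_iff.2 (by nlinarith)⟩
  have hlog : -Real.log (Real.exp (-β * t)) / β = t := by
    rw [Real.log_exp]; field_simp
  have hsum : ∑ k : Fin (p.natDegree + 1), p.coeff k * Real.exp (-β * ((k : ℕ) + 1) * t)
      = Real.exp (-β * t) * p.eval (Real.exp (-β * t)) := by
    rw [Polynomial.eval_eq_sum_range, Finset.sum_range, Finset.mul_sum]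
    refine Finset.sum_congr rfl fun k _ => ?_
    rw [show -β * ((k : ℕ) + 1) * t = (k : ℕ) * (-β * t) + -β * t by ring, Real.exp_add,
      Real.exp_nat_mul]
    ring
  rw [hlog, abs_sub_comm] at hx
  have hfac : h t - Real.exp (-β * t) * p.eval (Real.exp (-β * t))
      = (h t / Real.exp (-β * t) - p.eval (Real.exp (-β * t))) * Real.exp (-β * t) := by
    field_simp
  rw [hsum, hfac, abs_mul, abs_of_pos (Real.exp_pos _)]
  gcongr

/-- A compactly supported continuous function is approximated by exponential sums in `L¹` and `L²`
at once. -/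
lemma exists_exp_sum_integral_abs_add_sq_le {β : ℝ} (hβ : 0 < β) {h : ℝ → ℝ}
    (hc : Continuous h) (hs : HasCompactSupport h) {δ : ℝ} (hδ : 0 < δ) :
    ∃ n : ℕ, 1 ≤ n ∧ ∃ η : Fin n → ℝ,
      Integrable (fun t => |h t - ∑ k : Fin n, η k * Real.exp (-β * ((k : ℕ) + 1) * t)| +
        (h t - ∑ k : Fin n, η k * Real.exp (-β * ((k : ℕ) + 1) * t)) ^ 2)
        (volume.restrict (Ioi 0)) ∧
      ∫ t in Ioi (0 : ℝ), (|h t - ∑ k : Fin n, η k * Real.exp (-β * ((k : ℕ) + 1) * t)| +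
        (h t - ∑ k : Fin n, η k * Real.exp (-β * ((k : ℕ) + 1) * t)) ^ 2) ≤ δ := by
  have hexp : Integrable (fun t => Real.exp (-β * t)) (volume.restrict (Ioi 0)) :=
    exp_neg_integrableOn_Ioi 0 hβ
  set I := ∫ t in Ioi (0 : ℝ), Real.exp (-β * t) with hI
  have hI0 : 0 ≤ I := integral_nonneg fun t => (Real.exp_pos _).le
  set κ := min 1 (δ / (2 * (I + 1)))
  have hκ0 : 0 < κ := lt_min one_pos (by positivity)
  obtain ⟨n, hn, η, hη⟩ := exists_exp_sum_near_of_hasCompactSupport hβ hc hs hκ0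
  have hb : ∀ᵐ t ∂volume.restrict (Ioi (0 : ℝ)),
      |h t - ∑ k : Fin n, η k * Real.exp (-β * ((k : ℕ) + 1) * t)| +
        (h t - ∑ k : Fin n, η k * Real.exp (-β * ((k : ℕ) + 1) * t)) ^ 2
        ≤ 2 * κ * Real.exp (-β * t) := by
    filter_upwards [ae_restrict_mem measurableSet_Ioi] with t ht
    have h1 := hη t (le_of_lt ht)
    have h2 : Real.exp (-β * t) ≤ 1 :=
      Real.exp_le_one_iff.2 (by nlinarith [mem_Ioi.1 ht])
    have h3 : κ * Real.exp (-β * t) ≤ 1 :=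
      mul_le_one₀ (min_le_left _ _) (Real.exp_pos _).le h2
    rw [← sq_abs (_ - _)]
    nlinarith [abs_nonneg (h t - ∑ k : Fin n, η k * Real.exp (-β * ((k : ℕ) + 1) * t))]
  have hdom := hexp.const_mul (2 * κ)
  have hint : Integrable
      (fun t => |h t - ∑ k : Fin n, η k * Real.exp (-β * ((k : ℕ) + 1) * t)| +
        (h t - ∑ k : Fin n, η k * Real.exp (-β * ((k : ℕ) + 1) * t)) ^ 2)
      (volume.restrict (Ioi 0)) := by
    refine hdom.mono' (Continuous.aestronglyMeasurable (by fun_prop)) ?_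
    filter_upwards [hb] with t ht
    rwa [Real.norm_of_nonneg (by positivity)]
  refine ⟨n, hn, η, hint, (integral_mono_ae hint hdom hb).trans ?_⟩
  rw [integral_const_mul, ← hI]
  calc 2 * κ * I ≤ 2 * (δ / (2 * (I + 1))) * (I + 1) := by
        gcongr
        · exact min_le_right _ _
        · linarith
    _ = δ := by field_simp

/-- If `β > 0` and `φ : [0,∞) → ℝ` is measurable with
`∫₀^∞ |φ| < ∞` and `∫₀^∞ φ² < ∞`, then for every `ε > 0` there exist `n ≥ 1`
and coefficients `η₁, …, η_n` such that, with `g(t) = Σ_{k=1}^n η_k e^{−βkt}`,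
both `∫₀^∞ |φ − g| ≤ ε` and `(∫₀^∞ (φ − g)²)^{1/2} ≤ ε`. -/
theorem exp_sum_L1_L2_approx
    (β : ℝ) (hβ : 0 < β)
    (φ : ℝ → ℝ)
    (hφ_meas : Measurable φ)
    (hφ_int : IntegrableOn φ (Set.Ioi (0:ℝ)))
    (hφ_sq : IntegrableOn (fun t => φ t ^ 2) (Set.Ioi (0:ℝ)))
    (ε : ℝ) (hε : 0 < ε) :
    ∃ (n : ℕ), 1 ≤ n ∧ ∃ η : Fin n → ℝ,
      (∫ t in Set.Ioi (0:ℝ),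
        |φ t - ∑ k : Fin n, η k * Real.exp (-β * ((k : ℕ) + 1) * t)|) ≤ ε ∧
      Real.sqrt (∫ t in Set.Ioi (0:ℝ),
        (φ t - ∑ k : Fin n, η k * Real.exp (-β * ((k : ℕ) + 1) * t)) ^ 2) ≤ ε := by
  set δ := min ε (ε ^ 2) / 9 with hδ_def
  have hδ : 0 < δ := div_pos (lt_min hε (by positivity)) (by norm_num)
  obtain ⟨M, hM, hMδ⟩ := exists_truncate_integral_le hφ_meas hφ_int hφ_sq hδ
  have htr_meas : Measurable fun t => truncate M (φ t) :=
    (continuous_truncate M).measurable.comp hφ_meas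
  have htr_int : Integrable (fun t => truncate M (φ t)) (volume.restrict (Ioi 0)) :=
    Integrable.mono hφ_int htr_meas.aestronglyMeasurable
      (ae_of_all _ fun t => abs_truncate_le_abs hM (φ t))
  have hA : Integrable (fun t => |φ t - truncate M (φ t)| + (φ t - truncate M (φ t)) ^ 2)
      (volume.restrict (Ioi 0)) := by
    have hm : Measurable fun t => φ t - truncate M (φ t) := hφ_meas.sub htr_meas
    refine (hφ_int.abs.add hφ_sq).mono' (hm.abs.add (hm.pow_const 2)).aestronglyMeasurable
      (ae_of_all _ fun t => ?_)
    have h := abs_sub_truncate_le hM (φ t)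
    rw [Real.norm_of_nonneg (by positivity)]
    exact add_le_add h (sq_le_sq.2 h)
  obtain ⟨h, hc, hs, hB, hBδ⟩ := exists_hasCompactSupport_integral_abs_add_sq_le htr_int hM
    (fun t => abs_truncate_le hM (φ t)) hδ
  obtain ⟨n, hn, η, hC, hCδ⟩ := exists_exp_sum_integral_abs_add_sq_le hβ hc hs hδ
  refine ⟨n, hn, η, ?_⟩
  set g : ℝ → ℝ := fun t => ∑ k : Fin n, η k * Real.exp (-β * ((k : ℕ) + 1) * t)
  change Integrable (fun t => |h t - g t| + (h t - g t) ^ 2) (volume.restrict (Ioi 0)) at hC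
  change ∫ t in Ioi (0 : ℝ), (|h t - g t| + (h t - g t) ^ 2) ≤ δ at hCδ
  have hdom := ((hA.add hB).add hC).const_mul 3
  have hb : ∀ t, |φ t - g t| + (φ t - g t) ^ 2 ≤
      3 * ((|φ t - truncate M (φ t)| + (φ t - truncate M (φ t)) ^ 2) +
        (|truncate M (φ t) - h t| + (truncate M (φ t) - h t) ^ 2) +
        (|h t - g t| + (h t - g t) ^ 2)) := by
    intro t
    simpa using abs_add_sq_add_three_le (φ t - truncate M (φ t)) (truncate M (φ t) - h t)
      (h t - g t)
  have hdom_le : ∫ t in Ioi (0 : ℝ), 3 * ((|φ t - truncate M (φ t)| +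
      (φ t - truncate M (φ t)) ^ 2) + (|truncate M (φ t) - h t| + (truncate M (φ t) - h t) ^ 2) +
        (|h t - g t| + (h t - g t) ^ 2)) ≤ min ε (ε ^ 2) := by
    have hAB := integral_add (hA.add hB) hC
    simp only [Pi.add_apply] at hAB
    rw [integral_add hA hB] at hAB
    rw [integral_const_mul, hAB]
    have : min ε (ε ^ 2) = 9 * δ := by rw [hδ_def]; ring
    linarith
  constructor
  · refine le_trans (integral_mono_of_nonneg (ae_of_all _ fun t => abs_nonneg _) hdom
      (ae_of_all _ fun t => ?_)) (hdom_le.trans (min_le_left _ _))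
    exact (le_add_of_nonneg_right (sq_nonneg _)).trans (hb t)
  · refine Real.sqrt_le_iff.2 ⟨hε.le, ?_⟩
    refine le_trans (integral_mono_of_nonneg (ae_of_all _ fun t => sq_nonneg _) hdom
      (ae_of_all _ fun t => ?_)) (hdom_le.trans (min_le_right _ _))
    exact (le_add_of_nonneg_left (abs_nonneg _)).trans (hb t)
end
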